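/- Consider the 3-armed dueling bandit instance with preference gaps δ(1,2)=δ(1,3)=1/10, δ(2,1)=δ(3,1)=−1/10, δ(2,3)=1/2, δ(3,2)=−1/2, and δ(a,a)=0 for all a. Then for any horizon T ≥ 1 and any sequence of chosen pairs (i_t, j_t) ∈ {1,2,3}² for t = 1,…,T, there exists a weight vector w ∈ Δ³ such that the weighted Borda regret satisfies Σ_{t=1}^T (1/2)·(2·max_{a} b(a,w) − b(i_t,w) − b(j_t,w)) ≥ T/45. -/

import Mathlib

open Finset

/-- The gap matrix of the 3-armed dueling bandit instance:
δ(1,2)=δ(1,3)=1/10, δ(2,1)=δ(3,1)=−1/10, δ(2,3)=1/2, δ(3,2)=−1/2, δ(a,a)=0. -/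
noncomputable def duelGap : Fin 3 → Fin 3 → ℝ :=
  ![![0, 1/10, 1/10], ![-1/10, 0, 1/2], ![-1/10, -1/2, 0]]

/-- Weighted Borda score of arm `a` under weight vector `w`. -/
noncomputable def wbs (a : Fin 3) (w : Fin 3 → ℝ) : ℝ :=
  ∑ a' : Fin 3, duelGap a a' * w a'

theorem stmt_0 (T : ℕ) (hT : 1 ≤ T) (i j : Fin T → Fin 3) :
    ∃ w : Fin 3 → ℝ, (∀ a, 0 ≤ w a) ∧ (∑ a, w a = 1) ∧
      (T : ℝ) / 45 ≤
        ∑ t : Fin T, (1 / 2 : ℝ) *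
          (2 * (Finset.univ.sup' Finset.univ_nonempty fun a => wbs a w)
            - wbs (i t) w - wbs (j t) w) := by
  by_contra hcon
  push Not at hcon
  have h1 := hcon ![1, 0, 0] (by intro a; fin_cases a <;> simp) (by simp [Fin.sum_univ_three])
  have h3 := hcon ![0, 0, 1] (by intro a; fin_cases a <;> simp) (by simp [Fin.sum_univ_three])
  have m1 := Finset.le_sup' (fun a => wbs a ![1, 0, 0]) (Finset.mem_univ (0 : Fin 3))
  have m3 := Finset.le_sup' (fun a => wbs a ![0, 0, 1]) (Finset.mem_univ (1 : Fin 3))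
  generalize (Finset.univ.sup' Finset.univ_nonempty fun a => wbs a ![1, 0, 0]) = M1 at h1 m1
  generalize (Finset.univ.sup' Finset.univ_nonempty fun a => wbs a ![0, 0, 1]) = M3 at h3 m3
  have e1 : wbs 0 ![1, 0, 0] = 0 := by simp [wbs, duelGap, Fin.sum_univ_three]
  have e3 : wbs 1 ![0, 0, 1] = 1 / 2 := by simp [wbs, duelGap, Fin.sum_univ_three]
  simp only [e1] at m1
  simp only [e3] at m3
  have key : ∀ a : Fin 3, 4 * wbs a ![1, 0, 0] + wbs a ![0, 0, 1] ≤ 1 / 10 := by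
    intro a
    fin_cases a <;> simp [wbs, duelGap, Fin.sum_univ_three] <;> norm_num
  have hT' : (1 : ℝ) ≤ T := by exact_mod_cast hT
  have hs : ∑ t : Fin T, (2 / 5 : ℝ) ≤
      4 * (∑ t : Fin T, (1 / 2 : ℝ) * (2 * M1 - wbs (i t) ![1, 0, 0] - wbs (j t) ![1, 0, 0]))
      + ∑ t : Fin T, (1 / 2 : ℝ) * (2 * M3 - wbs (i t) ![0, 0, 1] - wbs (j t) ![0, 0, 1]) := by
    rw [Finset.mul_sum, ← Finset.sum_add_distrib]
    apply Finset.sum_le_sum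
    intro t _
    linarith [key (i t), key (j t)]
  simp only [Finset.sum_const, Finset.card_univ, Fintype.card_fin, nsmul_eq_mul] at hs
  linarith
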